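/- arXiv:2406.05033 — 4 statements merged into one kernel-verified Lean document; each statement's English description precedes it below -/
import Mathlib

section
/- For any loss ℓ satisfying Assumption A and any γ ∈ (1,2], there exists a one-dimensional non-separable classification problem with objective L and minimizer w*, an integer k > 1, and an initialization w₀, such that the gradient descent iterates with constant step size η = γ/L''(w*) started at w₀ converge to a cycle of period k > 1 (in particular they do not converge to w*). -/
open Filter Topology

/-- Assumption A on the individual loss function `ℓ`:
(i) `ℓ` is nonnegative, three-times continuously differentiable, strictly convex,
and tends to `0` at `-∞`;
(ii) `ℓ'` tends to `0` at `-∞` and to `1` at `+∞`;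
(iii) `ℓ''` is increasing on `(-∞, 0]`, decreasing on `[0, ∞)`, and
`(1/ε²)·ℓ''(1/ε) → 0` as `ε → 0`. -/
structure AssumptionA (ℓ : ℝ → ℝ) : Prop where
  nonneg : ∀ z, 0 ≤ ℓ z
  smooth : ContDiff ℝ 3 ℓ
  strictConvex : StrictConvexOn ℝ Set.univ ℓ
  tendsto_zero_atBot : Tendsto ℓ atBot (𝓝 0)
  deriv_tendsto_zero_atBot : Tendsto (deriv ℓ) atBot (𝓝 0)
  deriv_tendsto_one_atTop : Tendsto (deriv ℓ) atTop (𝓝 1)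
  secondDeriv_strictMono : StrictMonoOn (deriv (deriv ℓ)) (Set.Iic 0)
  secondDeriv_strictAnti : StrictAntiOn (deriv (deriv ℓ)) (Set.Ici 0)
  secondDeriv_decay :
    Tendsto (fun ε : ℝ => (1 / ε ^ 2) * deriv (deriv ℓ) (1 / ε)) (𝓝[≠] (0 : ℝ)) (𝓝 0)

namespace AssumptionA

variable {ℓ : ℝ → ℝ}

lemma hasDerivAt (hA : AssumptionA ℓ) (z : ℝ) : HasDerivAt ℓ (deriv ℓ z) z :=
  (hA.smooth.differentiable (by norm_num) z).hasDerivAt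

lemma contDiff_deriv (hA : AssumptionA ℓ) : ContDiff ℝ 2 (deriv ℓ) :=
  (contDiff_succ_iff_deriv (n := 2).1 (by rw [show (2 : WithTop ℕ∞) + 1 = 3 by norm_num]; exact hA.smooth)).2.2

lemma hasDerivAt_deriv (hA : AssumptionA ℓ) (z : ℝ) :
    HasDerivAt (deriv ℓ) (deriv (deriv ℓ) z) z :=
  (hA.contDiff_deriv.differentiable (by norm_num) z).hasDerivAt

lemma continuous_deriv (hA : AssumptionA ℓ) : Continuous (deriv ℓ) :=
  hA.contDiff_deriv.continuous

lemma continuous_secondDeriv (hA : AssumptionA ℓ) : Continuous (deriv (deriv ℓ)) :=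
  hA.contDiff_deriv.continuous_deriv (by norm_num)

lemma monotone_deriv (hA : AssumptionA ℓ) : Monotone (deriv ℓ) := by
  have h := hA.strictConvex.convexOn.monotoneOn_deriv fun x _ => (hA.hasDerivAt x).differentiableAt
  exact fun a b hab => h (Set.mem_univ a) (Set.mem_univ b) hab

lemma secondDeriv_pos (hA : AssumptionA ℓ) (z : ℝ) : 0 < deriv (deriv ℓ) z := by
  have hnn : ∀ x, 0 ≤ deriv (deriv ℓ) x := fun x => hA.monotone_deriv.deriv_nonneg
  rcases le_total z 0 with hz | hz
  · exact (hnn (z - 1)).trans_lt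
      (hA.secondDeriv_strictMono (by simp; linarith) (by simpa using hz) (by linarith))
  · exact (hnn (z + 1)).trans_lt
      (hA.secondDeriv_strictAnti (by simpa using hz) (by simp; linarith) (by linarith))

lemma strictMono_deriv (hA : AssumptionA ℓ) : StrictMono (deriv ℓ) :=
  strictMono_of_deriv_pos hA.secondDeriv_pos

lemma deriv_pos (hA : AssumptionA ℓ) (z : ℝ) : 0 < deriv ℓ z :=
  (hA.monotone_deriv.le_of_tendsto hA.deriv_tendsto_zero_atBot (z - 1)).trans_lt
    (hA.strictMono_deriv (by linarith))

lemma deriv_le_one (hA : AssumptionA ℓ) (z : ℝ) : deriv ℓ z ≤ 1 :=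
  hA.monotone_deriv.ge_of_tendsto hA.deriv_tendsto_one_atTop z

/-- By convexity, `z ℓ'(-2z) ≤ ℓ(-z)`. -/
lemma mul_deriv_le (hA : AssumptionA ℓ) {z : ℝ} (hz : 0 < z) :
    z * deriv ℓ (-(2 * z)) ≤ ℓ (-z) := by
  have h := hA.strictConvex.convexOn.deriv_le_slope (Set.mem_univ (-(2 * z)))
    (Set.mem_univ (-z)) (by linarith) (hA.hasDerivAt _).differentiableAt
  rw [slope_def_field, le_div_iff₀ (by linarith)] at h
  have := hA.nonneg (-(2 * z))
  nlinarith

lemma tendsto_mul_deriv (hA : AssumptionA ℓ) {u : ℝ} (hu : 0 < u) :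
    Tendsto (fun a : ℝ => a * deriv ℓ (-(a * u))) atTop (𝓝 0) := by
  have hlim : Tendsto (fun a : ℝ => 2 / u * ℓ (-(a * u / 2))) atTop (𝓝 0) := by
    have h1 : Tendsto (fun a : ℝ => -(a * u / 2)) atTop atBot :=
      tendsto_neg_atTop_atBot.comp
        ((tendsto_id.atTop_mul_const hu).atTop_div_const (by norm_num))
    simpa using (hA.tendsto_zero_atBot.comp h1).const_mul (2 / u)
  refine squeeze_zero' ?_ ?_ hlim
  · filter_upwards [eventually_gt_atTop 0] with a ha
    exact (mul_pos ha (hA.deriv_pos _)).le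
  · filter_upwards [eventually_gt_atTop 0] with a ha
    have h := hA.mul_deriv_le (z := a * u / 2) (by positivity)
    rw [show 2 * (a * u / 2) = a * u by ring] at h
    rw [div_mul_eq_mul_div, le_div_iff₀ hu]
    linarith

lemma tendsto_sq_mul_secondDeriv (hA : AssumptionA ℓ) {w : ℝ} (hw : 0 < w) :
    Tendsto (fun a : ℝ => a ^ 2 * deriv (deriv ℓ) (-(a * w))) atTop (𝓝 0) := by
  have h1 : Tendsto (fun a : ℝ => (-(a * w))⁻¹) atTop (𝓝[≠] 0) := by
    refine tendsto_nhdsWithin_iff.2 ⟨?_, ?_⟩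
    · exact tendsto_inv_atBot_zero.comp
        (tendsto_neg_atTop_atBot.comp (tendsto_id.atTop_mul_const hw))
    · filter_upwards [eventually_gt_atTop 0] with a ha
      have : a * w ≠ 0 := by positivity
      exact inv_ne_zero (neg_ne_zero.2 this)
  have h2 := (hA.secondDeriv_decay.comp h1).const_mul (1 / w ^ 2)
  rw [mul_zero] at h2
  refine h2.congr' ?_
  filter_upwards with a
  simp only [Function.comp, one_div, inv_inv, inv_pow]
  field_simp

/-- The derivative of the sum of the losses of the data `-1, b, a` (all with label `1`). -/
lemma hasDerivAt_sum (hA : AssumptionA ℓ) (b a w : ℝ) :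
    HasDerivAt (fun w => ℓ w + ℓ (-(b * w)) + ℓ (-(a * w)))
      (deriv ℓ w - b * deriv ℓ (-(b * w)) - a * deriv ℓ (-(a * w))) w := by
  have key : ∀ c : ℝ, HasDerivAt (fun w => ℓ (-(c * w))) (deriv ℓ (-(c * w)) * -(c * 1)) w :=
    fun c => (hA.hasDerivAt (-(c * w))).comp w ((hasDerivAt_id w).const_mul c).neg
  refine (((hA.hasDerivAt w).add (key b)).add (key a)).congr_deriv ?_
  ring

lemma hasDerivAt_deriv_sum (hA : AssumptionA ℓ) (b a w : ℝ) :
    HasDerivAt (fun w => deriv ℓ w - b * deriv ℓ (-(b * w)) - a * deriv ℓ (-(a * w)))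
      (deriv (deriv ℓ) w + b ^ 2 * deriv (deriv ℓ) (-(b * w))
        + a ^ 2 * deriv (deriv ℓ) (-(a * w))) w := by
  have key : ∀ c : ℝ, HasDerivAt (fun w => deriv ℓ (-(c * w)))
      (deriv (deriv ℓ) (-(c * w)) * -(c * 1)) w :=
    fun c => HasDerivAt.comp (h₂ := deriv ℓ) (h := fun w => -(c * w)) w
      (hA.hasDerivAt_deriv (-(c * w))) ((hasDerivAt_id w).const_mul c).neg
  refine (((hA.hasDerivAt_deriv w).sub ((key b).const_mul b)).sub
    ((key a).const_mul a)).congr_deriv ?_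
  ring

/-- Near the minimizer `0` of `ℓ(w) + ℓ(-w)`, a gradient step with normalized step size `γ > 1`
overshoots to the other side. -/
lemma exists_overshoot_symmetric (hA : AssumptionA ℓ) {γ : ℝ} (hγ : 1 < γ) :
    ∃ K u ρ : ℝ, 0 < u ∧ 0 < ρ ∧ 2 * deriv (deriv ℓ) 0 < K ∧
      (u + ρ) * K < γ * (deriv ℓ u - deriv ℓ (-u)) := by
  have h0 := hA.secondDeriv_pos 0
  set K := (1 + γ) * deriv (deriv ℓ) 0 with hK
  have hKpos : 0 < K := by positivity
  have hd : HasDerivAt (fun u => γ * (deriv ℓ u - deriv ℓ (-u)))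
      (γ * (2 * deriv (deriv ℓ) 0)) 0 := by
    have h1 : HasDerivAt (fun u => deriv ℓ (-u)) (deriv (deriv ℓ) (-0) * -1) 0 :=
      (hA.hasDerivAt_deriv (-0)).comp (0 : ℝ) (hasDerivAt_neg 0)
    refine (((hA.hasDerivAt_deriv 0).sub h1).const_mul γ).congr_deriv ?_
    rw [neg_zero]
    ring
  have hev : ∀ᶠ u in 𝓝[>] (0 : ℝ), K < u⁻¹ * (γ * (deriv ℓ u - deriv ℓ (-u))) := by
    have := hd.tendsto_slope_zero_right.eventually_const_lt (u := K) (by rw [hK]; nlinarith)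
    simpa using this
  obtain ⟨u, hu, hu0⟩ := (hev.and self_mem_nhdsWithin).exists
  have hu0 : 0 < u := hu0
  rw [lt_inv_mul_iff₀ hu0] at hu
  refine ⟨K, u, (γ * (deriv ℓ u - deriv ℓ (-u)) - u * K) / (2 * K), hu0,
    div_pos (by linarith) (by linarith), by rw [hK]; nlinarith, ?_⟩
  rw [add_mul, div_mul_eq_mul_div, mul_div_mul_right _ _ hKpos.ne']
  linarith

/-- The overshoot persists for data `-1, b` with `b` slightly larger than `1`, for which the
minimizer is positive. -/
lemma exists_overshoot_asymmetric (hA : AssumptionA ℓ) {γ : ℝ} (hγ : 1 < γ) :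
    ∃ K u ρ b w₀ : ℝ, 0 < ρ ∧ 0 < b ∧ 0 < w₀ ∧ w₀ < u ∧
      deriv ℓ w₀ - b * deriv ℓ (-(b * w₀)) = 0 ∧
      deriv (deriv ℓ) w₀ + b ^ 2 * deriv (deriv ℓ) (-(b * w₀)) < K ∧
      (u + ρ) * K < γ * (deriv ℓ u - b * deriv ℓ (-(b * u))) := by
  obtain ⟨K, u, ρ, hu, hρ, hK, huK⟩ := hA.exists_overshoot_symmetric hγ
  have hg := hA.continuous_deriv
  have hh := hA.continuous_secondDeriv
  have h1 : ∀ᶠ p : ℝ × ℝ in 𝓝 1 ×ˢ 𝓝 0,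
      deriv (deriv ℓ) p.2 + p.1 ^ 2 * deriv (deriv ℓ) (-(p.1 * p.2)) < K := by
    rw [← nhds_prod_eq]
    have hc : Continuous fun p : ℝ × ℝ =>
        deriv (deriv ℓ) p.2 + p.1 ^ 2 * deriv (deriv ℓ) (-(p.1 * p.2)) := by fun_prop
    refine hc.continuousAt.eventually_lt continuousAt_const ?_
    norm_num
    linarith
  obtain ⟨P, hP, Q, hQ, hPQ⟩ := eventually_prod_iff.1 h1
  obtain ⟨ε, hε, hεQ⟩ := Metric.eventually_nhds_iff.1 hQ
  set δ := min (ε / 2) (u / 2)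
  have hδ0 : 0 < δ := by positivity
  have hδε : δ ≤ ε / 2 := min_le_left _ _
  have hδu : δ ≤ u / 2 := min_le_right _ _
  have h2 : ∀ᶠ b in 𝓝 (1 : ℝ), 0 < deriv ℓ δ - b * deriv ℓ (-(b * δ)) := by
    have hc : Continuous fun b : ℝ => deriv ℓ δ - b * deriv ℓ (-(b * δ)) := by fun_prop
    refine continuousAt_const.eventually_lt hc.continuousAt ?_
    have := hA.strictMono_deriv (show -δ < δ by linarith)
    simpa using this
  have h3 : ∀ᶠ b in 𝓝 (1 : ℝ), (u + ρ) * K < γ * (deriv ℓ u - b * deriv ℓ (-(b * u))) := by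
    have hc : Continuous fun b : ℝ => γ * (deriv ℓ u - b * deriv ℓ (-(b * u))) := by fun_prop
    refine continuousAt_const.eventually_lt hc.continuousAt ?_
    simpa using huK
  obtain ⟨b, ⟨hb2, hb3, hbP⟩, hb⟩ :=
    (((h2.and (h3.and hP)).filter_mono nhdsWithin_le_nhds).and
      (self_mem_nhdsWithin : Set.Ioi (1 : ℝ) ∈ 𝓝[>] 1)).exists
  have hb : 1 < b := hb
  have hc : Continuous fun w : ℝ => deriv ℓ w - b * deriv ℓ (-(b * w)) := by fun_prop
  have hneg : deriv ℓ 0 - b * deriv ℓ (-(b * 0)) < 0 := by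
    have := hA.deriv_pos 0
    rw [mul_zero, neg_zero]
    nlinarith
  obtain ⟨w₀, hw₀, hroot⟩ :=
    intermediate_value_Ioo hδ0.le hc.continuousOn (Set.mem_Ioo.2 ⟨hneg, hb2⟩)
  refine ⟨K, u, ρ, b, w₀, hρ, by linarith, hw₀.1, by linarith [hw₀.2], hroot, ?_, hb3⟩
  refine hPQ hbP (hεQ ?_)
  rw [Real.dist_eq, sub_zero, abs_of_pos hw₀.1]
  linarith [hw₀.2]

/-- There are data `-1, b, a` whose objective has a point `u` that two normalized gradient steps
move further away from the minimizer, to the right. -/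
lemma exists_data (hA : AssumptionA ℓ) {γ : ℝ} (hγ : 1 < γ) :
    ∃ u ρ b a w : ℝ, 0 < ρ ∧ 0 < b ∧ 0 < a ∧ w < u ∧
      deriv ℓ w - b * deriv ℓ (-(b * w)) - a * deriv ℓ (-(a * w)) = 0 ∧
      (u + ρ) * (deriv (deriv ℓ) w + b ^ 2 * deriv (deriv ℓ) (-(b * w))
        + a ^ 2 * deriv (deriv ℓ) (-(a * w))) <
        γ * (deriv ℓ u - b * deriv ℓ (-(b * u)) - a * deriv ℓ (-(a * u))) ∧
      (deriv ℓ u - b * deriv ℓ (-(b * u)) - a * deriv ℓ (-(a * u))) +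
        (deriv ℓ (-ρ) - b * deriv ℓ (-(b * -ρ)) - a * deriv ℓ (-(a * -ρ))) < 0 := by
  obtain ⟨K, u, ρ, b, w₀, hρ, hb, hw₀, hw₀u, hroot, hK, huK⟩ := hA.exists_overshoot_asymmetric hγ
  have hg := hA.continuous_deriv
  have hh := hA.continuous_secondDeriv
  obtain ⟨K₁, hK₁, hK₁K⟩ := exists_between hK
  have hnear : ∀ᶠ w in 𝓝 w₀,
      deriv (deriv ℓ) w + b ^ 2 * deriv (deriv ℓ) (-(b * w)) < K₁ := by
    have hc : Continuous fun w : ℝ =>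
      deriv (deriv ℓ) w + b ^ 2 * deriv (deriv ℓ) (-(b * w)) := by fun_prop
    exact hc.continuousAt.eventually_lt continuousAt_const hK₁
  obtain ⟨ε, hε, hεK⟩ := Metric.eventually_nhds_iff.1 hnear
  set w₁ := w₀ + min (ε / 2) ((u - w₀) / 2) with hw₁
  have hmin : 0 < min (ε / 2) ((u - w₀) / 2) := lt_min (by linarith) (by linarith)
  have hw₁ε : w₁ ≤ w₀ + ε / 2 := by rw [hw₁]; gcongr; exact min_le_left _ _
  have hw₁u : w₁ ≤ w₀ + (u - w₀) / 2 := by rw [hw₁]; gcongr; exact min_le_right _ _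
  have hw₀₁ : w₀ < w₁ := by linarith
  have hpos : 0 < deriv ℓ w₁ - b * deriv ℓ (-(b * w₁)) := by
    have h1 := hA.strictMono_deriv hw₀₁
    have h2 : deriv ℓ (-(b * w₁)) ≤ deriv ℓ (-(b * w₀)) :=
      hA.monotone_deriv (by nlinarith)
    nlinarith
  have e1 := (hA.tendsto_mul_deriv (hw₀.trans hw₀₁)).eventually_lt_const hpos
  have e2 := (hA.tendsto_sq_mul_secondDeriv hw₀).eventually_lt_const (sub_pos.2 hK₁K)
  have e3 : ∀ᶠ a : ℝ in atTop, (u + ρ) * K <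
      γ * (deriv ℓ u - b * deriv ℓ (-(b * u)) - a * deriv ℓ (-(a * u))) := by
    have := ((hA.tendsto_mul_deriv (hw₀.trans hw₀u)).const_sub
      (deriv ℓ u - b * deriv ℓ (-(b * u)))).const_mul γ
    rw [sub_zero] at this
    exact this.eventually_const_lt huK
  have h0 := hA.deriv_pos 0
  obtain ⟨a, ha1, ha2, ha3, ha, ha4⟩ := (e1.and (e2.and (e3.and
    ((eventually_gt_atTop 0).and (eventually_gt_atTop (2 / deriv ℓ 0)))))).exists
  have hc : Continuous fun w : ℝ =>
    deriv ℓ w - b * deriv ℓ (-(b * w)) - a * deriv ℓ (-(a * w)) := by fun_prop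
  have hneg : deriv ℓ w₀ - b * deriv ℓ (-(b * w₀)) - a * deriv ℓ (-(a * w₀)) < 0 := by
    have := mul_pos ha (hA.deriv_pos (-(a * w₀)))
    linarith
  obtain ⟨w, hw, hwroot⟩ := intermediate_value_Ioo hw₀₁.le hc.continuousOn
    (Set.mem_Ioo.2 ⟨hneg, sub_pos.2 ha1⟩)
  refine ⟨u, ρ, b, a, w, hρ, hb, ha, by linarith [hw.2], hwroot, ?_, ?_⟩
  · refine lt_of_le_of_lt ?_ ha3
    have h1 := @hεK w (by
      rw [Real.dist_eq, abs_of_pos (sub_pos.2 hw.1)]; linarith [hw.2])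
    have haw₀ : 0 < a * w₀ := mul_pos ha hw₀
    have haw : a * w₀ < a * w := mul_lt_mul_of_pos_left hw.1 ha
    have h2 : deriv (deriv ℓ) (-(a * w)) ≤ deriv (deriv ℓ) (-(a * w₀)) :=
      hA.secondDeriv_strictMono.monotoneOn (by simp; linarith) (by simp; linarith) (by linarith)
    have h3 := mul_le_mul_of_nonneg_left h2 (sq_nonneg a)
    exact mul_le_mul_of_nonneg_left (by linarith) (by linarith)
  · have p1 := mul_pos hb (hA.deriv_pos (-(b * u)))
    have p2 := mul_pos ha (hA.deriv_pos (-(a * u)))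
    have p3 := mul_pos hb (hA.deriv_pos (-(b * -ρ)))
    have p4 := hA.monotone_deriv (show (0 : ℝ) ≤ -(a * -ρ) by nlinarith)
    have p5 := mul_le_mul_of_nonneg_left p4 ha.le
    rw [div_lt_iff₀ h0] at ha4
    linarith [hA.deriv_le_one u, hA.deriv_le_one (-ρ)]

end AssumptionA

/-- If two steps of `T(w) = w - η f(w)` move some point to the right of the zero of `f` further to
the right, and `f` is increasing and bounded above, then `T` has a 2-cycle. -/
lemma exists_two_cycle {f : ℝ → ℝ} (hc : Continuous f) (hf : StrictMono f) {z u η B : ℝ}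
    (hz : f z = 0) (hB : ∀ w, f w ≤ B) (hη : 0 < η) (hzu : z < u)
    (hu : f u + f (u - η * f u) < 0) :
    ∃ p, z < p ∧ f p + f (p - η * f p) = 0 := by
  have hB0 : 0 ≤ B := hz ▸ hB z
  have hηB := mul_nonneg hη.le hB0
  have hv : 0 ≤ f (u + η * B) + f (u + η * B - η * f (u + η * B)) := by
    have h1 : f z ≤ f (u + η * B) := hf.monotone (by linarith)
    have h2 : f z ≤ f (u + η * B - η * f (u + η * B)) :=
      hf.monotone (by linarith [mul_le_mul_of_nonneg_left (hB (u + η * B)) hη.le])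
    linarith
  have hcont : Continuous fun w => f w + f (w - η * f w) := by fun_prop
  obtain ⟨p, hp, hp0⟩ := intermediate_value_Icc (show u ≤ u + η * B by linarith)
    hcont.continuousOn (Set.mem_Icc.2 ⟨hu.le, hv⟩)
  exact ⟨p, hzu.trans_le hp.1, hp0⟩

/-- A differentiable function with monotone derivative is minimal where its derivative vanishes. -/
lemma le_of_monotone_deriv {L : ℝ → ℝ} (hL : Differentiable ℝ L) (hmono : Monotone (deriv L))
    {z : ℝ} (hz : deriv L z = 0) (w : ℝ) : L z ≤ L w :=
  isMinOn_univ_of_deriv hL.continuous.continuousAt hL.differentiableOn hL.differentiableOn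
    (fun _ hx => hz ▸ hmono (le_of_lt hx)) (fun _ hx => hz ▸ hmono (le_of_lt hx)) (Set.mem_univ w)

/-- For any loss `ℓ` satisfying Assumption A and any `γ ∈ (1,2]`,
there exists a one-dimensional non-separable classification problem on which some GD
trajectory with constant step size `η = γ/L''(w*)` converges to a cycle of period
`k > 1` (in particular it does not converge to `w*`). -/
theorem gd_one_dim_cycle
    (ℓ : ℝ → ℝ) (hA : AssumptionA ℓ)
    (γ : ℝ) (hγ : γ ∈ Set.Ioc (1 : ℝ) 2) :
    ∃ (n : ℕ), 0 < n ∧ ∃ (x y : Fin n → ℝ),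
      (∀ i, y i = 1 ∨ y i = -1) ∧
      (∀ w : ℝ, ∃ i, y i * (w * x i) ≤ 0) ∧
      ∃ (L : ℝ → ℝ),
        (∀ w : ℝ, L w = (1 / (n : ℝ)) * ∑ i, ℓ (-(y i) * (x i * w))) ∧
        ∃ (wstar : ℝ),
          (∀ w, L wstar ≤ L w) ∧
          ∃ (η : ℝ), η = γ / deriv (deriv L) wstar ∧
          ∃ (k : ℕ), 1 < k ∧
          ∃ (c : ℕ → ℝ) (w₀ : ℝ) (w : ℕ → ℝ),
            (∀ j₁ j₂, j₁ < k → j₂ < k → c j₁ = c j₂ → j₁ = j₂) ∧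
            (∀ j, c j - η * deriv L (c j) = c (j + 1)) ∧
            c k = c 0 ∧
            w 0 = w₀ ∧
            (∀ t, w (t + 1) = w t - η * deriv L (w t)) ∧
            (∀ j, Tendsto (fun t => w (k * t + j)) atTop (𝓝 (c j))) ∧
            ¬ Tendsto w atTop (𝓝 wstar) := by
  obtain ⟨u, ρ, b, a, z, hρ, hb, ha, hzu, hroot, hstep, hback⟩ := hA.exists_data hγ.1
  set f : ℝ → ℝ := fun w => deriv ℓ w - b * deriv ℓ (-(b * w)) - a * deriv ℓ (-(a * w)) with hfdef
  set F : ℝ → ℝ := fun w => deriv (deriv ℓ) w + b ^ 2 * deriv (deriv ℓ) (-(b * w))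
        + a ^ 2 * deriv (deriv ℓ) (-(a * w)) with hFdef
  change f z = 0 at hroot
  change (u + ρ) * F z < γ * f u at hstep
  change f u + f (-ρ) < 0 at hback
  have hf' : ∀ w, HasDerivAt f (F w) w := hA.hasDerivAt_deriv_sum b a
  have hFpos : ∀ w, 0 < F w := fun w => by
    have h1 := hA.secondDeriv_pos w
    have h2 := hA.secondDeriv_pos (-(b * w))
    have h3 := hA.secondDeriv_pos (-(a * w))
    positivity
  have hfmono : StrictMono f := strictMono_of_deriv_pos fun w => by
    rw [(hf' w).deriv]; exact hFpos w
  have hfcont : Continuous f := continuous_iff_continuousAt.2 fun w => (hf' w).continuousAt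
  have hf1 : ∀ w, f w ≤ 1 := fun w => by
    have h1 := hA.deriv_le_one w
    have h2 := mul_pos hb (hA.deriv_pos (-(b * w)))
    have h3 := mul_pos ha (hA.deriv_pos (-(a * w)))
    simp only [hfdef]
    linarith
  have hη : 0 < γ / F z := div_pos (by linarith [hγ.1]) (hFpos z)
  have hu : f u + f (u - γ / F z * f u) < 0 := by
    refine lt_of_le_of_lt ?_ hback
    gcongr
    refine hfmono.monotone ?_
    have := (le_div_iff₀ (hFpos z)).2 hstep.le
    rw [div_mul_eq_mul_div]
    linarith
  obtain ⟨p, hzp, hp⟩ := exists_two_cycle hfcont hfmono hroot hf1 hη hzu hu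
  set L : ℝ → ℝ := fun w => 1 / 3 * (ℓ w + ℓ (-(b * w)) + ℓ (-(a * w))) with hLdef
  have hL' : ∀ w, HasDerivAt L (1 / 3 * f w) w := fun w => (hA.hasDerivAt_sum b a w).const_mul _
  have hdL : deriv L = fun w => 1 / 3 * f w := funext fun w => (hL' w).deriv
  have hddL : deriv (deriv L) z = 1 / 3 * F z := by
    rw [hdL]
    exact ((hf' z).const_mul _).deriv
  have hstepsize : ∀ w, γ / deriv (deriv L) z * deriv L w = γ / F z * f w := fun w => by
    have := (hFpos z).ne'
    rw [hddL, hdL]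
    field_simp
  set T : ℝ → ℝ := fun w => w - γ / F z * f w with hT
  have hfp : 0 < f p := hroot ▸ hfmono hzp
  have hTp : T p ≠ p := by
    have := mul_pos hη hfp
    simp only [hT]
    linarith
  have hTT : T (T p) = p := by
    have h1 : f (T p) = -f p := by linarith
    change T p - γ / F z * f (T p) = p
    rw [h1, hT]
    ring
  have hper : ∀ t j, T^[2 * t + j] p = T^[j] p := fun t j => by
    rw [add_comm, Function.iterate_add_apply, Function.iterate_mul]
    congr 1
    exact Function.iterate_fixed hTT t
  refine ⟨3, by norm_num, ![-1, b, a], fun _ => 1, fun _ => Or.inl rfl, fun w => ?_, L,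
    fun w => ?_, z, ?_, _, rfl, 2, one_lt_two, fun j => T^[j] p, p, fun j => T^[j] p, ?_, ?_, hTT,
    rfl, ?_, ?_, ?_⟩
  · rcases le_total 0 w with hw | hw
    · exact ⟨0, by simpa using hw⟩
    · exact ⟨1, by simpa using mul_nonpos_of_nonpos_of_nonneg hw hb.le⟩
  · simp [hLdef, Fin.sum_univ_three]
  · refine le_of_monotone_deriv (fun w => (hL' w).differentiableAt) ?_ ?_
    · rw [hdL]
      exact hfmono.monotone.const_mul (by norm_num)
    · rw [hdL]
      simp [hroot]
  · intro i j hi hj hij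
    interval_cases i <;> interval_cases j
    · rfl
    · exact absurd hij.symm hTp
    · exact absurd hij hTp
    · rfl
  · intro j
    rw [hstepsize]
    exact (Function.iterate_succ_apply' T j p).symm
  · intro j
    rw [hstepsize]
    exact Function.iterate_succ_apply' T j p
  · intro j
    simp only [hper]
    exact tendsto_const_nhds
  · intro h
    have h2 := h.comp (tendsto_id.const_mul_atTop' (r := 2) two_pos)
    have h3 : Tendsto (fun _ : ℕ => p) atTop (𝓝 z) := by
      refine h2.congr fun t => ?_
      simpa using hper t 0
    exact hzp.ne' (tendsto_nhds_unique tendsto_const_nhds h3)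
end

section
/- For any loss ℓ satisfying Assumption A, any γ ∈ (0,2], and any dimension d > 2, there exists a d-dimensional non-separable classification problem with objective L and minimizer w*, an integer k > 1, and an initialization w₀, such that the gradient descent iterates with constant step size η = γ/λ, where λ = λ_max(∇²L(w*)), started at w₀ converge to a cycle of period k > 1. -/
open Filter Topology

namespace AssumptionA

variable {ℓ : ℝ → ℝ}

lemma differentiable (hA : AssumptionA ℓ) : Differentiable ℝ ℓ :=
  hA.smooth.differentiable (by norm_num)

lemma deriv2_nonneg (hA : AssumptionA ℓ) (z : ℝ) : 0 ≤ deriv (deriv ℓ) z :=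
  hA.strictMono_deriv.monotone.deriv_nonneg

lemma deriv2_pos (hA : AssumptionA ℓ) {z : ℝ} (hz : z ≤ 0) : 0 < deriv (deriv ℓ) z :=
  (hA.deriv2_nonneg (z - 1)).trans_lt
    (hA.secondDeriv_strictMono (by simp; linarith) hz (by linarith))

/-- The tangent line inequality. -/
lemma tangent_le (hA : AssumptionA ℓ) (z z' : ℝ) :
    ℓ z + deriv ℓ z * (z' - z) ≤ ℓ z' := by
  have hc := hA.strictConvex.convexOn
  rcases lt_trichotomy z z' with h | rfl | h
  · have := hc.deriv_le_slope (Set.mem_univ z) (Set.mem_univ z') h (hA.differentiable z)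
    rw [slope_def_field, le_div_iff₀ (by linarith)] at this
    linarith
  · simp
  · have := hc.slope_le_deriv (Set.mem_univ z') (Set.mem_univ z) h (hA.differentiable z)
    rw [slope_def_field, div_le_iff₀ (by linarith)] at this
    linarith

lemma tendsto_sq_mul_deriv2 (hA : AssumptionA ℓ) :
    Tendsto (fun t : ℝ => t ^ 2 * deriv (deriv ℓ) (-t)) atTop (𝓝 0) := by
  have h : Tendsto (fun t : ℝ => -t⁻¹) atTop (𝓝[≠] 0) := by
    refine tendsto_nhdsWithin_iff.2 ⟨by simpa using (tendsto_inv_atTop_zero (𝕜 := ℝ)).neg, ?_⟩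
    filter_upwards [eventually_gt_atTop 0] with t ht
    simpa using ht.ne'
  refine (hA.secondDeriv_decay.comp h).congr fun t => ?_
  simp [inv_neg]

/-- A point where the pinning force `ℓ'(v) - 2ℓ'(-2v)` vanishes. -/
lemma exists_balance (hA : AssumptionA ℓ) :
    ∃ v > 0, deriv ℓ v - 2 * deriv ℓ (-2 * v) = 0 := by
  have hcont := hA.contDiff_deriv.continuous
  have hbot : Tendsto (fun v : ℝ => -2 * v) atTop atBot :=
    tendsto_id.const_mul_atTop_of_neg (by norm_num)
  have hlim : Tendsto (fun v => deriv ℓ v - 2 * deriv ℓ (-2 * v)) atTop (𝓝 (1 - 2 * 0)) :=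
    hA.deriv_tendsto_one_atTop.sub ((hA.deriv_tendsto_zero_atBot.comp hbot).const_mul 2)
  obtain ⟨M, hM, hM0⟩ := ((hlim.eventually (lt_mem_nhds (by norm_num : (0 : ℝ) < 1 - 2 * 0))).and
    (eventually_gt_atTop 0)).exists
  have h0 := hA.deriv_pos 0
  obtain ⟨v, hv, hv'⟩ := intermediate_value_Ioo hM0.le
    (f := fun v => deriv ℓ v - 2 * deriv ℓ (-2 * v)) (by fun_prop)
    (show (0 : ℝ) ∈ Set.Ioo _ _ from ⟨by simp; linarith, hM⟩)
  exact ⟨v, hv.1, hv'⟩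

/-- Parameters of the planar problem `ℓ(u - bv) + ℓ(-u - bv) + N (ℓ(v) + ℓ(-2v))`: its
`v`-derivative vanishes at `(0, V)` and at `(u, v)`, while the second `u`-derivative at `(0, V)`
is small compared with the slope of the `u`-derivative between these points. -/
lemma exists_params (hA : AssumptionA ℓ) {γ : ℝ} (hγ : 0 < γ) :
    ∃ (N : ℕ) (b u V v : ℝ), 0 < N ∧ 0 < b ∧ 0 < u ∧ 0 < V ∧
      N * (deriv ℓ V - 2 * deriv ℓ (-2 * V)) = b * (deriv ℓ (-b * V) + deriv ℓ (-b * V)) ∧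
      N * (deriv ℓ v - 2 * deriv ℓ (-2 * v)) =
        b * (deriv ℓ (u - b * v) + deriv ℓ (-u - b * v)) ∧
      0 < deriv ℓ (u - b * v) - deriv ℓ (-u - b * v) ∧
      2 * deriv (deriv ℓ) (-b * V) * (2 * u) ≤
        γ * (deriv ℓ (u - b * v) - deriv ℓ (-u - b * v)) := by
  obtain ⟨v₀, hv₀, hbal⟩ := hA.exists_balance
  have hcont := hA.contDiff_deriv.continuous
  have h0 := hA.deriv_pos 0
  have hmono := hA.strictMono_deriv
  have hbot : Tendsto (fun t : ℝ => -2 * t) atTop atBot :=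
    tendsto_id.const_mul_atTop_of_neg (by norm_num)
  obtain ⟨t, ht1, htd, ht2⟩ : ∃ t : ℝ, 1 ≤ t ∧ t ^ 2 * deriv (deriv ℓ) (-t) < γ * deriv ℓ 0 / 16 ∧
      deriv ℓ (-2 * t) < deriv ℓ 0 / 2 :=
    ((eventually_ge_atTop 1).and
      ((hA.tendsto_sq_mul_deriv2.eventually (gt_mem_nhds (by positivity))).and
      ((hA.deriv_tendsto_zero_atBot.comp hbot).eventually (gt_mem_nhds (by positivity))))).exists
  have hb : 0 < t / v₀ := by positivity
  have hbv : t / v₀ * v₀ = t := by field_simp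
  generalize t / v₀ = b at hb hbv
  have hforce : 0 < deriv ℓ (2 * v₀) - 2 * deriv ℓ (-2 * (2 * v₀)) := by
    have h1 := hmono (show v₀ < 2 * v₀ by linarith)
    have h2 := hmono (show -2 * (2 * v₀) < -2 * v₀ by linarith)
    linarith
  obtain ⟨N, hN⟩ := exists_nat_ge (2 * b / (deriv ℓ (2 * v₀) - 2 * deriv ℓ (-2 * (2 * v₀))))
  rw [div_le_iff₀ hforce] at hN
  have hstat : ∀ u : ℝ, ∃ v ∈ Set.Icc v₀ (2 * v₀),
      N * (deriv ℓ v - 2 * deriv ℓ (-2 * v)) -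
        b * (deriv ℓ (u - b * v) + deriv ℓ (-u - b * v)) = 0 := by
    intro u
    refine intermediate_value_Icc (by linarith)
      (f := fun v => N * (deriv ℓ v - 2 * deriv ℓ (-2 * v)) -
        b * (deriv ℓ (u - b * v) + deriv ℓ (-u - b * v))) (by fun_prop) ⟨?_, ?_⟩
    · have h1 := hA.deriv_pos (u - b * v₀)
      have h2 := hA.deriv_pos (-u - b * v₀)
      simp only [hbal, mul_zero, zero_sub, Left.neg_nonpos_iff]
      positivity
    · have h1 := hA.deriv_le_one (u - b * (2 * v₀))
      have h2 := hA.deriv_le_one (-u - b * (2 * v₀))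
      have := mul_le_mul_of_nonneg_left (add_le_add h1 h2) hb.le
      linarith
  obtain ⟨V, hV, hVs⟩ := hstat 0
  obtain ⟨v, hv, hvs⟩ := hstat (2 * t)
  have hbV : t ≤ b * V := hbv ▸ mul_le_mul_of_nonneg_left hV.1 hb.le
  have hbv1 : t ≤ b * v := hbv ▸ mul_le_mul_of_nonneg_left hv.1 hb.le
  have hbv2 : b * v ≤ 2 * t := by
    have := mul_le_mul_of_nonneg_left hv.2 hb.le
    linarith
  have hD : deriv ℓ 0 / 2 < deriv ℓ (2 * t - b * v) - deriv ℓ (-(2 * t) - b * v) := by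
    have h1 := hmono.monotone (show 0 ≤ 2 * t - b * v by linarith)
    have h2 := hmono.monotone (show -(2 * t) - b * v ≤ -2 * t by linarith)
    linarith
  have hNpos : 0 < N := by
    rcases N.eq_zero_or_pos with rfl | h
    · simp at hN
      linarith
    · exact h
  refine ⟨N, b, 2 * t, V, v, hNpos, hb, by linarith, hv₀.trans_le hV.1, ?_, by linarith,
    by linarith, ?_⟩
  · simp only [neg_zero, zero_sub] at hVs
    simp only [neg_mul b V]
    linarith
  · have h1 : deriv (deriv ℓ) (-b * V) ≤ deriv (deriv ℓ) (-t) :=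
      hA.secondDeriv_strictMono.monotoneOn (by simp; nlinarith) (by simp; linarith) (by linarith)
    have h2 : t * deriv (deriv ℓ) (-t) ≤ t ^ 2 * deriv (deriv ℓ) (-t) :=
      mul_le_mul_of_nonneg_right (by nlinarith) (hA.deriv2_nonneg _)
    have h3 := mul_le_mul_of_nonneg_left h1 (show 0 ≤ t by linarith)
    have h4 := mul_le_mul_of_nonneg_left hD.le hγ.le
    linarith

end AssumptionA

/-- The vector `(α, β, 0, …, 0)`. -/
def planarVec (m : ℕ) (α β : ℝ) : Fin (m + 2) → ℝ :=
  Fin.cons α (Fin.cons β 0)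

@[simp] lemma planarVec_zero (m : ℕ) (α β : ℝ) : planarVec m α β 0 = α := rfl

@[simp] lemma planarVec_one (m : ℕ) (α β : ℝ) : planarVec m α β 1 = β := rfl

@[simp] lemma planarVec_succ_succ (m : ℕ) (α β : ℝ) (j : Fin m) :
    planarVec m α β j.succ.succ = 0 := rfl

lemma sum_mul_planarVec {m : ℕ} (w : Fin (m + 2) → ℝ) (α β : ℝ) :
    ∑ j, w j * planarVec m α β j = w 0 * α + w 1 * β := by
  simp [Fin.sum_univ_succ]

/-- The features of the planar problem: `N` copies of `(0, 1)`, `N` copies of `(0, -2)`, and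
`(±a, -b)`. -/
def planarData (m N : ℕ) (a b : ℝ) : Fin (N + N + 2) → Fin (m + 2) → ℝ :=
  Fin.append (Fin.append (fun _ => planarVec m 0 1) (fun _ => planarVec m 0 (-2)))
    ![planarVec m a (-b), planarVec m (-a) (-b)]

lemma sum_planarData (m N : ℕ) (a b : ℝ) (f : (Fin (m + 2) → ℝ) → ℝ) :
    ∑ i, f (planarData m N a b i) =
      N * f (planarVec m 0 1) + N * f (planarVec m 0 (-2)) +
        (f (planarVec m a (-b)) + f (planarVec m (-a) (-b))) := by
  simp only [planarData, Fin.sum_univ_add, Fin.append_left, Fin.append_right]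
  simp

/-- For any loss `ℓ` satisfying Assumption A, any `γ ∈ (0,2]`, and any
dimension `d > 2`, there exists a `d`-dimensional non-separable classification problem
on which some GD trajectory with constant step size `η = γ/λ_max(∇²L(w*))` converges to
a cycle of period `k > 1`. -/
theorem gd_high_dim_cycle
    (ℓ : ℝ → ℝ) (hA : AssumptionA ℓ)
    (γ : ℝ) (hγ : γ ∈ Set.Ioc (0 : ℝ) 2)
    (d : ℕ) (hd : 2 < d) :
    ∃ (n : ℕ), 0 < n ∧ ∃ (x : Fin n → Fin d → ℝ) (y : Fin n → ℝ),
      (∀ i, y i = 1 ∨ y i = -1) ∧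
      (∀ w : Fin d → ℝ, ∃ i, y i * (∑ j, w j * x i j) ≤ 0) ∧
      ∃ (L : (Fin d → ℝ) → ℝ) (g : (Fin d → ℝ) → Fin d → ℝ)
        (H : Matrix (Fin d) (Fin d) ℝ),
        -- the objective
        (∀ w, L w = (1 / (n : ℝ)) * ∑ i, ℓ (-(y i) * ∑ j, w j * x i j)) ∧
        -- its gradient
        (∀ w j, g w j =
          (1 / (n : ℝ)) * ∑ i, deriv ℓ (-(y i) * ∑ j', w j' * x i j') * (-(y i) * x i j)) ∧
        ∃ (wstar : Fin d → ℝ),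
          (∀ w, L wstar ≤ L w) ∧
          -- the Hessian at the minimizer
          (∀ a b, H a b =
            (1 / (n : ℝ)) *
              ∑ i, deriv (deriv ℓ) (-(y i) * ∑ j', wstar j' * x i j') * x i a * x i b) ∧
          ∃ (lam : ℝ),
            -- `lam` is the largest eigenvalue of the Hessian at the minimizer
            (∃ v : Fin d → ℝ, v ≠ 0 ∧ H.mulVec v = lam • v) ∧
            (∀ (μ : ℝ) (v : Fin d → ℝ), v ≠ 0 → H.mulVec v = μ • v → μ ≤ lam) ∧
            ∃ (η : ℝ), η = γ / lam ∧
            ∃ (k : ℕ), 1 < k ∧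
            ∃ (c : ℕ → Fin d → ℝ) (w₀ : Fin d → ℝ) (w : ℕ → Fin d → ℝ),
              (∀ j₁ j₂, j₁ < k → j₂ < k → c j₁ = c j₂ → j₁ = j₂) ∧
              (∀ j, c j - η • g (c j) = c (j + 1)) ∧
              c k = c 0 ∧
              w 0 = w₀ ∧
              (∀ t, w (t + 1) = w t - η • g (w t)) ∧
              (∀ j, Tendsto (fun t => w (k * t + j)) atTop (𝓝 (c j))) := by
  obtain ⟨m, rfl⟩ : ∃ m, d = m + 2 := ⟨d - 2, by omega⟩
  obtain ⟨hγ, -⟩ := hγ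
  obtain ⟨N, b, u, V, v, hN, hb, hu, hV, hVs, hvs, hD, hle⟩ := hA.exists_params hγ
  have hbV : 0 < deriv (deriv ℓ) (-b * V) := hA.deriv2_pos (by nlinarith)
  set D := deriv ℓ (u - b * v) - deriv ℓ (-u - b * v) with hDdef
  set h : ℝ := N * (deriv (deriv ℓ) V + 4 * deriv (deriv ℓ) (-2 * V)) +
    2 * b ^ 2 * deriv (deriv ℓ) (-b * V) with hh
  have hhpos : 0 < h := by
    have h1 := hA.deriv2_nonneg V
    have h2 := hA.deriv2_nonneg (-2 * V)
    positivity
  obtain ⟨a, ha, ha2⟩ : ∃ a : ℝ, 0 < a ∧ γ * a ^ 2 * D = 2 * u * h :=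
    ⟨√(2 * u * h / (γ * D)), by positivity, by
      rw [Real.sq_sqrt (by positivity)]; field_simp⟩
  have hcurv : a ^ 2 * (2 * deriv (deriv ℓ) (-b * V)) ≤ h := by
    have := mul_le_mul_of_nonneg_left hle (sq_nonneg a)
    have h3 : (a ^ 2 * (2 * deriv (deriv ℓ) (-b * V))) * (2 * u) ≤ h * (2 * u) := by linarith
    exact le_of_mul_le_mul_right h3 (by positivity)
  set n := N + N + 2 with hn
  have hnpos : (0 : ℝ) < n := by rw [hn]; positivity
  set X := planarData m N a b with hX
  let g : (Fin (m + 2) → ℝ) → Fin (m + 2) → ℝ := fun w j =>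
    (1 / (n : ℝ)) * ∑ i, deriv ℓ (-(-1) * ∑ j', w j' * X i j') * (-(-1) * X i j)
  have hg : ∀ w, g w = planarVec m
      (a * (deriv ℓ (a * w 0 - b * w 1) - deriv ℓ (-(a * w 0) - b * w 1)) / n)
      ((N * (deriv ℓ (w 1) - 2 * deriv ℓ (-2 * w 1)) -
        b * (deriv ℓ (a * w 0 - b * w 1) + deriv ℓ (-(a * w 0) - b * w 1))) / n) := by
    intro w
    funext j
    have e1 : w 0 * a + w 1 * -b = a * w 0 - b * w 1 := by ring
    have e2 : w 0 * -a + w 1 * -b = -(a * w 0) - b * w 1 := by ring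
    have e3 : w 0 * 0 + w 1 * 1 = w 1 := by ring
    have e4 : w 0 * 0 + w 1 * -2 = -2 * w 1 := by ring
    simp only [g, hX, neg_neg, one_mul]
    rw [sum_planarData m N a b fun x => deriv ℓ (∑ j', w j' * x j') * x j]
    simp only [sum_mul_planarVec, e1, e2, e3, e4]
    refine Fin.cases ?_ (fun j => Fin.cases ?_ (fun j => ?_) j) j
    · simp; ring
    · simp; ring
    · simp
  let H : Matrix (Fin (m + 2)) (Fin (m + 2)) ℝ := fun j k =>
    (1 / (n : ℝ)) * ∑ i, deriv (deriv ℓ) (-(-1) * ∑ j', planarVec m 0 V j' * X i j') *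
      X i j * X i k
  have hH : ∀ z, H.mulVec z =
      planarVec m (a ^ 2 * (2 * deriv (deriv ℓ) (-b * V)) / n * z 0) (h / n * z 1) := by
    intro z
    funext j
    simp only [Matrix.mulVec, dotProduct, H, hX, neg_neg, one_mul]
    have hsum : ∀ k, ∑ i, deriv (deriv ℓ) (∑ j', planarVec m 0 V j' * planarData m N a b i j') *
        planarData m N a b i j * planarData m N a b i k = _ := fun k =>
      sum_planarData m N a b fun x =>
        deriv (deriv ℓ) (∑ j', planarVec m 0 V j' * x j') * x j * x k
    simp only [hsum, sum_mul_planarVec]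
    simp only [Fin.sum_univ_succ]
    have e1 : V * -b = -b * V := by ring
    have e2 : V * -2 = -2 * V := by ring
    refine Fin.cases ?_ (fun j => Fin.cases ?_ (fun j => ?_) j) j
    · simp [e1, e2]; left; ring
    · simp [e1, e2, hh]; left; ring
    · simp
  have hcycle : ∀ s : ℝ, s = 1 ∨ s = -1 →
      planarVec m (s * (u / a)) v - (γ / (h / n)) • g (planarVec m (s * (u / a)) v) =
        planarVec m (-s * (u / a)) v := by
    intro s hs
    have ea : a * (u / a) = u := by field_simp
    have key : γ / (h / n) * (a * D / n) = 2 * (u / a) := by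
      field_simp
      linarith
    rw [hg]
    funext j
    refine Fin.cases ?_ (fun j => Fin.cases ?_ (fun j => ?_) j) j
    · rcases hs with rfl | rfl
      · simp [ea, ← hDdef, key]; ring
      · have : a * (deriv ℓ (-u - b * v) - deriv ℓ (u - b * v)) / n = -(a * D / n) := by
          rw [hDdef]; ring
        simp [ea, this, key]; ring
    · rcases hs with rfl | rfl
      · simp only [neg_mul] at hvs
        simp [ea, hvs]
      · simp only [neg_mul] at hvs
        simp [ea, hvs, add_comm (deriv ℓ (-u - b * v))]
    · simp
  let c : ℕ → Fin (m + 2) → ℝ := fun j => planarVec m ((-1) ^ j * (u / a)) v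
  have hc : ∀ j, c j - (γ / (h / n)) • g (c j) = c (j + 1) := fun j => by
    simp only [c, hcycle _ (neg_one_pow_eq_or ℝ j), pow_succ, mul_neg_one]
  refine ⟨n, by omega, X, fun _ => -1, fun _ => Or.inr rfl, fun w => ?_, 
    fun w => (1 / (n : ℝ)) * ∑ i, ℓ (-(-1) * ∑ j, w j * X i j), g, H,
    fun w => rfl, fun w j => rfl, planarVec m 0 V, fun w => ?_, fun j k => rfl, h / n,
    ⟨planarVec m 0 1, fun h0 => ?_, ?_⟩, fun μ z hz hμ => ?_, _, rfl, 2, one_lt_two, c, c 0, c,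
    fun j₁ j₂ h1 h2 h12 => ?_, hc, ?_, rfl, fun t => (hc t).symm, fun j => ?_⟩
  · rcases le_total 0 (w 1) with hw | hw
    · refine ⟨Fin.castAdd 2 (Fin.castAdd N ⟨0, hN⟩), ?_⟩
      simp only [hX, planarData, Fin.append_left, sum_mul_planarVec]
      linarith
    · refine ⟨Fin.castAdd 2 (Fin.natAdd N ⟨0, hN⟩), ?_⟩
      simp only [hX, planarData, Fin.append_left, Fin.append_right, sum_mul_planarVec]
      linarith
  · refine mul_le_mul_of_nonneg_left ?_ (by positivity)
    simp only [hX, neg_neg, one_mul]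
    rw [sum_planarData m N a b fun x => ℓ (∑ j', w j' * x j'),
      sum_planarData m N a b fun x => ℓ (∑ j', planarVec m 0 V j' * x j')]
    simp only [sum_mul_planarVec, planarVec_zero, planarVec_one]
    have e1 : 0 * a + V * -b = -b * V := by ring
    have e2 : 0 * -a + V * -b = -b * V := by ring
    have e3 : 0 * 0 + V * 1 = V := by ring
    have e4 : 0 * 0 + V * -2 = -2 * V := by ring
    rw [e1, e2, e3, e4]
    have t1 := hA.tangent_le (-b * V) (w 0 * a + w 1 * -b)
    have t2 := hA.tangent_le (-b * V) (w 0 * -a + w 1 * -b)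
    have t3 := mul_le_mul_of_nonneg_left (hA.tangent_le V (w 0 * 0 + w 1 * 1)) N.cast_nonneg
    have t4 := mul_le_mul_of_nonneg_left (hA.tangent_le (-2 * V) (w 0 * 0 + w 1 * -2))
      N.cast_nonneg
    have t5 := congrArg (· * (w 1 - V)) hVs
    linarith
  · simpa using congrFun h0 1
  · rw [hH]
    funext j
    refine Fin.cases ?_ (fun j => Fin.cases ?_ (fun j => ?_) j) j <;> simp
  · rw [hH] at hμ
    have h0 := congrFun hμ 0
    have h1 := congrFun hμ 1
    simp only [planarVec_zero, planarVec_one, Pi.smul_apply, smul_eq_mul] at h0 h1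
    by_cases hz1 : z 1 = 0
    · by_cases hz0 : z 0 = 0
      · have hμ0 : μ = 0 := by
          by_contra hne
          refine hz (funext fun j => Fin.cases hz0 (fun j => Fin.cases hz1 (fun j => ?_) j) j)
          simpa [hne] using (congrFun hμ j.succ.succ).symm
        rw [hμ0]
        positivity
      · rw [← mul_right_cancel₀ hz0 h0]
        gcongr
    · exact (mul_right_cancel₀ hz1 h1).ge
  · have h0 := congrFun h12 0
    have : 0 < u / a := by positivity
    interval_cases j₁ <;> interval_cases j₂ <;> simp only [c, planarVec_zero] at h0 ⊢ <;> linarith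
  · simp [c]
  · have : ∀ t, c (2 * t + j) = c j := fun t => by simp [c, pow_add, pow_mul]
    simp [this]
end

section
/- If ℓ satisfies Assumption A, then for every z ∈ ℝ, lim_{ε→0} ε² · ℓ(z/ε²) = max{z, 0}. -/
open Filter Topology

/-- A function whose derivative tends to `a` at `+∞` is asymptotically linear with slope `a`. -/
lemma tendsto_div_self_of_tendsto_deriv_atTop {f : ℝ → ℝ} {a : ℝ} (hf : Differentiable ℝ f)
    (h : Tendsto (deriv f) atTop (𝓝 a)) : Tendsto (fun x => f x / x) atTop (𝓝 a) := by
  have hg : Differentiable ℝ (fun x => f x - a * x) := by fun_prop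
  have hderiv : ∀ x, deriv (fun x => f x - a * x) x = deriv f x - a := fun x => by
    have hd := (hf x).hasDerivAt.fun_sub ((hasDerivAt_id x).const_mul a)
    simpa using hd.deriv
  have hlittle : (fun x => f x - a * x) =o[atTop] (fun x : ℝ => x) := by
    refine Asymptotics.isLittleO_iff.2 fun c hc => ?_
    obtain ⟨N, hN⟩ := eventually_atTop.1 (Metric.tendsto_nhds.1 h (c / 2) (half_pos hc))
    set X := max N 0
    have hlarge := (tendsto_id.const_mul_atTop (half_pos hc)).eventually_ge_atTop ‖f X - a * X‖
    filter_upwards [hlarge, eventually_ge_atTop X] with x hx hXx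
    have hmv : ‖(f x - a * x) - (f X - a * X)‖ ≤ c / 2 * ‖x - X‖ := by
      refine (convex_Ici X).norm_image_sub_le_of_norm_deriv_le (f := fun x => f x - a * x)
        (fun y _ => hg y) (fun y hy => ?_) Set.self_mem_Ici hXx
      rw [hderiv, Real.norm_eq_abs, ← Real.dist_eq]
      exact (hN y ((le_max_left N 0).trans hy)).le
    have hX : 0 ≤ X := le_max_right N 0
    rw [Real.norm_of_nonneg (sub_nonneg.2 hXx)] at hmv
    rw [Real.norm_of_nonneg (hX.trans hXx)]
    have htri := norm_le_norm_add_norm_sub' (f x - a * x) (f X - a * X)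
    simp only [id] at hx
    nlinarith [mul_nonneg hc.le hX]
  have hlim := hlittle.tendsto_div_nhds_zero.add_const a
  rw [zero_add] at hlim
  refine hlim.congr' ?_
  filter_upwards [eventually_gt_atTop 0] with x hx
  field_simp
  ring

/-- If `ℓ` satisfies Assumption A, then for every `z : ℝ`,
`ε² · ℓ(z/ε²) → max {z, 0}` as `ε → 0`. -/
theorem limit_is_relu
    (ℓ : ℝ → ℝ) (hA : AssumptionA ℓ) (z : ℝ) :
    Tendsto (fun ε : ℝ => ε ^ 2 * ℓ (z / ε ^ 2)) (𝓝[≠] (0 : ℝ)) (𝓝 (max z 0)) := by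
  have hsq : Tendsto (fun ε : ℝ => ε ^ 2) (𝓝[≠] 0) (𝓝 0) := by
    have hc : Continuous fun ε : ℝ => ε ^ 2 := by fun_prop
    simpa using (hc.tendsto 0).mono_left nhdsWithin_le_nhds
  have hne : ∀ᶠ ε : ℝ in 𝓝[≠] 0, ε ≠ 0 := self_mem_nhdsWithin
  have hinv : Tendsto (fun ε : ℝ => (ε ^ 2)⁻¹) (𝓝[≠] 0) atTop :=
    (tendsto_nhdsWithin_iff.2
      ⟨hsq, hne.mono fun _ hε => sq_pos_of_ne_zero hε⟩).inv_tendsto_nhdsGT_zero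
  rcases lt_trichotomy z 0 with hz | rfl | hz
  · have hx : Tendsto (fun ε : ℝ => z / ε ^ 2) (𝓝[≠] 0) atBot := by
      simpa only [div_eq_mul_inv] using hinv.const_mul_atTop_of_neg hz
    simpa [max_eq_right hz.le] using hsq.mul (hA.tendsto_zero_atBot.comp hx)
  · simpa using hsq.mul_const (ℓ 0)
  · have hx : Tendsto (fun ε : ℝ => z / ε ^ 2) (𝓝[≠] 0) atTop := by
      simpa only [div_eq_mul_inv] using hinv.const_mul_atTop hz
    have hslope := tendsto_div_self_of_tendsto_deriv_atTop
      (hA.smooth.differentiable (by norm_num)) hA.deriv_tendsto_one_atTop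
    have hlim := (hslope.comp hx).const_mul z
    rw [mul_one] at hlim
    rw [max_eq_left hz.le]
    refine hlim.congr' ?_
    filter_upwards [hne] with ε hε
    simp only [Function.comp_apply]
    field_simp
end

section
/- Let ℓ satisfy Assumption A and let L be the two-dimensional coordinate-decoupled classification objective with m₁ copies of e₁, n₁ copies of −e₁, m₂ copies of e₂, n₂ copies of −e₂ (all labels 1) and minimizer w* = (w₁*, w₂*) with w₁* > w₂* > 0. Then for every point w' = (w₁', w₂') with w₁' > w₁* and w₂' > w₂*, and every step size η > 0, there exists w = (w₁, w₂) with w₁ > w₁' and w₂ > w₂' such that T(w) = w − η∇L(w) = w'. -/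
open Filter Topology

/-- One gradient step in one coordinate: a point strictly to the right of a minimizer has a
preimage strictly further to the right. -/
theorem AssumptionA.exists_gt_step_eq {ℓ : ℝ → ℝ} (hA : AssumptionA ℓ) {m n : ℝ}
    (hm : 0 ≤ m) (hn : 0 < n) {x₀ p c : ℝ} (hc : 0 < c)
    (hmin : ∀ x, m * ℓ (-x₀) + n * ℓ x₀ ≤ m * ℓ (-x) + n * ℓ x) (hp : x₀ < p) :
    ∃ x, p < x ∧ x - c * (n * deriv ℓ x - m * deriv ℓ (-x)) = p := by
  have hdiff : Differentiable ℝ ℓ := hA.smooth.differentiable (by norm_num)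
  have hcont : Continuous (deriv ℓ) := hA.smooth.continuous_deriv (by norm_num)
  have hmono : StrictMono (deriv ℓ) :=
    strictMonoOn_univ.mp (hA.strictConvex.strictMonoOn_deriv fun x _ => hdiff x)
  have hle : ∀ x, deriv ℓ x ≤ 1 := hmono.monotone.ge_of_tendsto hA.deriv_tendsto_one_atTop
  have hge : ∀ x, 0 ≤ deriv ℓ x := hmono.monotone.le_of_tendsto hA.deriv_tendsto_zero_atBot
  have hcrit : n * deriv ℓ x₀ - m * deriv ℓ (-x₀) = 0 := by
    have hd : HasDerivAt (fun x => m * ℓ (-x) + n * ℓ x)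
        (m * (deriv ℓ (-x₀) * -1) + n * deriv ℓ x₀) x₀ :=
      (((hdiff (-x₀)).hasDerivAt.comp x₀ (hasDerivAt_neg x₀)).const_mul m).add
        ((hdiff x₀).hasDerivAt.const_mul n)
    have hz := IsLocalMin.hasDerivAt_eq_zero (Eventually.of_forall hmin) hd
    linarith
  have hgrad : 0 < n * deriv ℓ p - m * deriv ℓ (-p) := by
    have h₁ := mul_lt_mul_of_pos_left (hmono hp) hn
    have h₂ := mul_le_mul_of_nonneg_left (hmono (neg_lt_neg hp)).le hm
    linarith
  have hq : p < p + c * n := by linarith [mul_pos hc hn]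
  obtain ⟨x, hx, hxp⟩ := intermediate_value_Icc hq.le
    (f := fun x => x - c * (n * deriv ℓ x - m * deriv ℓ (-x))) (by fun_prop)
    (show p ∈ Set.Icc _ _ from ⟨by linarith [mul_pos hc hgrad], by
      have h₁ := mul_le_mul_of_nonneg_left (hle (p + c * n)) hn.le
      have h₂ := mul_nonneg hm (hge (-(p + c * n)))
      have h₃ : c * (n * deriv ℓ (p + c * n) - m * deriv ℓ (-(p + c * n))) ≤ c * n :=
        mul_le_mul_of_nonneg_left (by linarith) hc.le
      linarith⟩)
  refine ⟨x, hx.1.lt_of_ne ?_, hxp⟩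
  rintro rfl
  have := mul_pos hc hgrad
  simp only at hxp
  linarith

/-- (Trajectory extension in 2D.) For the coordinate-decoupled
two-dimensional objective with minimizer `w* = (w₁*, w₂*)`, `w₁* > w₂* > 0`, every
point `w'` with `w'.1 > w₁*` and `w'.2 > w₂*`, and every step size `η > 0`, there is a
point `w` with `w.1 > w'.1`, `w.2 > w'.2` and `T(w) = w - η∇L(w) = w'`. -/
theorem trajectory_extension_two_dim
    (ℓ : ℝ → ℝ) (hA : AssumptionA ℓ)
    (m₁ n₁ m₂ n₂ : ℕ) (hm₁ : 0 < m₁) (hn₁ : 0 < n₁) (hm₂ : 0 < m₂) (hn₂ : 0 < n₂)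
    (N : ℕ) (hN : N = m₁ + n₁ + m₂ + n₂)
    (L : ℝ × ℝ → ℝ)
    (hL : ∀ w : ℝ × ℝ, L w = (1 / (N : ℝ)) *
      ((m₁ : ℝ) * ℓ (-w.1) + (n₁ : ℝ) * ℓ w.1 +
       (m₂ : ℝ) * ℓ (-w.2) + (n₂ : ℝ) * ℓ w.2))
    (g : ℝ × ℝ → ℝ × ℝ)
    (hg : ∀ w : ℝ × ℝ, g w =
      ((1 / (N : ℝ)) * ((n₁ : ℝ) * deriv ℓ w.1 - (m₁ : ℝ) * deriv ℓ (-w.1)),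
       (1 / (N : ℝ)) * ((n₂ : ℝ) * deriv ℓ w.2 - (m₂ : ℝ) * deriv ℓ (-w.2))))
    (wstar : ℝ × ℝ) (hmin : ∀ w, L wstar ≤ L w)
    (hpos : 0 < wstar.2) (hord : wstar.2 < wstar.1)
    (w' : ℝ × ℝ) (hw1 : wstar.1 < w'.1) (hw2 : wstar.2 < w'.2)
    (η : ℝ) (hη : 0 < η) :
    ∃ w : ℝ × ℝ, w'.1 < w.1 ∧ w'.2 < w.2 ∧ w - η • g w = w' := by
  have hN' : (0 : ℝ) < 1 / (N : ℝ) := one_div_pos.mpr (Nat.cast_pos.mpr (by omega))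
  have hc : 0 < η * (1 / (N : ℝ)) := mul_pos hη hN'
  have hmin' : ∀ w : ℝ × ℝ, _ := fun w =>
    le_of_mul_le_mul_left (by simpa only [hL] using hmin w) hN'
  obtain ⟨x, hx, hxp⟩ := hA.exists_gt_step_eq (m := m₁) (n := n₁) (x₀ := wstar.1)
    (Nat.cast_nonneg _) (Nat.cast_pos.mpr hn₁) hc
    (fun x => by have := hmin' (x, wstar.2); simp only at this; linarith) hw1
  obtain ⟨y, hy, hyp⟩ := hA.exists_gt_step_eq (m := m₂) (n := n₂) (x₀ := wstar.2)
    (Nat.cast_nonneg _) (Nat.cast_pos.mpr hn₂) hc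
    (fun y => by have := hmin' (wstar.1, y); simp only at this; linarith) hw2
  refine ⟨(x, y), hx, hy, ?_⟩
  rw [hg]
  refine Prod.ext ?_ ?_
  · simpa [mul_assoc] using hxp
  · simpa [mul_assoc] using hyp
end
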